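/- Let k ≥ 2 be an integer. In the ℚ-vector space ℚ^ℕ of sequences of rationals indexed by positive integers, write ζ^◇(κ) := (ζ^◇_N(κ))_{N≥1}. Then the family {ζ^◇(l) : l ∈ I^{≥2}_k} is a basis of the ℚ-subspace Z^◇_k of ℚ^ℕ spanned by {ζ^◇(κ) : κ ∈ I^adm_k}; in particular dim_ℚ Z^◇_k = F_{k−1}, the (k−1)-st Fibonacci number (F_1 = F_2 = 1). -/

import Mathlib

open scoped Classical

/-- The modified multiple harmonic sum `ζ◇_N(k)` for an index given as a list. -/
noncomputable def zdiaL (N : ℕ) (k : List ℕ) : ℚ :=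
  ∑ A : Finset (Fin k.length),
    if ∀ i ∈ A, k.get i = 1 then
      ∑ n ∈ Finset.univ.filter (fun n : Fin k.length → Fin N =>
        (∀ i, 0 < (n i : ℕ)) ∧
        ∀ (i : Fin k.length) (h : (i : ℕ) + 1 < k.length),
          if i ∈ A then n i ≤ n ⟨(i : ℕ) + 1, h⟩ else n i < n ⟨(i : ℕ) + 1, h⟩),
        ∏ i : Fin k.length,
          if i ∈ A then (1 : ℚ) / ((N : ℚ) - ((n i : ℕ) : ℚ))
          else (1 : ℚ) / (((n i : ℕ) : ℚ) ^ k.get i)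
    else 0

/-- The sequence `ζ◇(k) = (ζ◇_N(k))_{N ≥ 1}`, an element of `ℚ^ℕ` (sequences of
rationals indexed by the positive integers). -/
noncomputable def zdiaSeq (k : List ℕ) : ℕ+ → ℚ := fun N => zdiaL (N : ℕ) k

/-- operator attached to the entry `k`. -/
noncomputable def opX (k : ℕ) : (ℕ → ℕ → ℚ) →ₗ[ℚ] (ℕ → ℕ → ℚ) where
  toFun F N n := (∑ m ∈ Finset.Ico 1 n, (1 / (m : ℚ) ^ k) * F N m) +
    if k = 1 then ∑ m ∈ Finset.Ico 1 (n + 1), (1 / ((N : ℚ) - m)) * F N m else 0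
  map_add' F G := by
    funext N n
    split_ifs <;> simp [mul_add, Finset.sum_add_distrib] <;> ring
  map_smul' c F := by
    funext N n
    split_ifs <;> simp [Finset.mul_sum, mul_add, mul_left_comm]

/-- multiplication by `N ^ (-j)`. -/
noncomputable def opT (j : ℕ) : (ℕ → ℕ → ℚ) →ₗ[ℚ] (ℕ → ℕ → ℚ) where
  toFun F N n := (1 / (N : ℚ)) ^ j * F N n
  map_add' F G := by funext N n; simp [mul_add]
  map_smul' c F := by funext N n; simp [mul_left_comm]

noncomputable def wrd : List ℕ → (ℕ → ℕ → ℚ)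
  | [] => fun _ _ => 1
  | k :: h => opX k (wrd h)

lemma opX_one (F : ℕ → ℕ → ℚ) (N n : ℕ) : opX 1 F N n =
    (∑ m ∈ Finset.Ico 1 n, (1 / (m : ℚ)) * F N m) +
      ∑ m ∈ Finset.Ico 1 (n + 1), (1 / ((N : ℚ) - m)) * F N m := by
  simp [opX]

lemma opX_ge (k : ℕ) (hk : 2 ≤ k) (F : ℕ → ℕ → ℚ) (N n : ℕ) : opX k F N n =
    ∑ m ∈ Finset.Ico 1 n, (1 / (m : ℚ) ^ k) * F N m := by
  have : k ≠ 1 := by omega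
  simp [opX, this]

lemma opT_apply (j : ℕ) (F : ℕ → ℕ → ℚ) (N n : ℕ) : opT j F N n = (1 / (N : ℚ)) ^ j * F N n := rfl

lemma opX_opT (k j : ℕ) (F : ℕ → ℕ → ℚ) : opX k (opT j F) = opT j (opX k F) := by
  funext N n
  simp only [opX, opT, LinearMap.coe_mk, AddHom.coe_mk]
  split_ifs <;> simp only [mul_add, Finset.mul_sum, mul_left_comm, mul_zero]

lemma opT_opT (i j : ℕ) (F : ℕ → ℕ → ℚ) : opT i (opT j F) = opT (i + j) F := by
  funext N n
  simp only [opT_apply, pow_add]; ring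

lemma opT_zero (F : ℕ → ℕ → ℚ) : opT 0 F = F := by
  funext N n
  simp [opT_apply]

noncomputable def PP (i : ℕ) (w : ℤ) : Submodule ℚ (ℕ → ℕ → ℚ) :=
  Submodule.span ℚ {F | ∃ (j : ℕ) (h : List ℕ), i ≤ j ∧ (j : ℤ) + (h.sum : ℤ) = w ∧
    (∀ x ∈ h, 1 ≤ x) ∧ F = opT j (wrd h)}

noncomputable def AA (i : ℕ) (w : ℤ) : Submodule ℚ (ℕ → ℕ → ℚ) :=
  Submodule.span ℚ {F | ∃ (j : ℕ) (h : List ℕ), i ≤ j ∧ (j : ℤ) + (h.sum : ℤ) = w ∧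
    (∀ x ∈ h, 1 ≤ x) ∧ (∀ x ∈ h.head?, 2 ≤ x) ∧ F = opT j (wrd h)}

lemma PP_mono {i i' : ℕ} (h : i' ≤ i) (w : ℤ) : PP i w ≤ PP i' w := by
  apply Submodule.span_mono
  rintro F ⟨j, l, h1, h2⟩
  exact ⟨j, l, h.trans h1, h2⟩

lemma AA_mono {i i' : ℕ} (h : i' ≤ i) (w : ℤ) : AA i w ≤ AA i' w := by
  apply Submodule.span_mono
  rintro F ⟨j, l, h1, h2⟩
  exact ⟨j, l, h.trans h1, h2⟩

lemma AA_le_PP (i : ℕ) (w : ℤ) : AA i w ≤ PP i w := by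
  apply Submodule.span_mono
  rintro F ⟨j, l, h1, h2, h3, h4, h5⟩
  exact ⟨j, l, h1, h2, h3, h5⟩

lemma opX_PP {i : ℕ} {w w' : ℤ} {k : ℕ} (hk : 1 ≤ k) {F} (hF : F ∈ PP i w) (hw : w + k = w') :
    opX k F ∈ PP i w' := by
  refine Submodule.span_induction (p := fun F _ => opX k F ∈ PP i w') ?_ (by simp) ?_ ?_ hF
  · rintro _ ⟨j, h, h1, h2, h3, rfl⟩
    refine Submodule.subset_span ⟨j, k :: h, h1, ?_, ?_, ?_⟩
    · simp only [List.sum_cons]; omega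
    · simpa using ⟨hk, h3⟩
    · rw [opX_opT]; rfl
  · intro x y _ _ hx hy
    rw [map_add]; exact add_mem hx hy
  · intro c x _ hx
    rw [map_smul]; exact Submodule.smul_mem _ _ hx

lemma opX_AA {i : ℕ} {w w' : ℤ} {k : ℕ} (hk : 2 ≤ k) {F} (hF : F ∈ PP i w) (hw : w + k = w') :
    opX k F ∈ AA i w' := by
  refine Submodule.span_induction (p := fun F _ => opX k F ∈ AA i w') ?_ (by simp) ?_ ?_ hF
  · rintro _ ⟨j, h, h1, h2, h3, rfl⟩
    refine Submodule.subset_span ⟨j, k :: h, h1, ?_, ?_, ?_, ?_⟩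
    · simp only [List.sum_cons]; omega
    · simpa using ⟨by omega, h3⟩
    · simpa using hk
    · rw [opX_opT]; rfl
  · intro x y _ _ hx hy
    rw [map_add]; exact add_mem hx hy
  · intro c x _ hx
    rw [map_smul]; exact Submodule.smul_mem _ _ hx

lemma opT_PP {i i' : ℕ} {w w' : ℤ} {j : ℕ} {F} (hF : F ∈ PP i w) (hi : i' ≤ i + j)
    (hw : w + j = w') : opT j F ∈ PP i' w' := by
  refine Submodule.span_induction (p := fun F _ => opT j F ∈ PP i' w') ?_ (by simp) ?_ ?_ hF
  · rintro _ ⟨j', h, h1, h2, h3, rfl⟩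
    refine Submodule.subset_span ⟨j + j', h, by omega, ?_, h3, ?_⟩
    · omega
    · rw [opT_opT]
  · intro x y _ _ hx hy
    rw [map_add]; exact add_mem hx hy
  · intro c x _ hx
    rw [map_smul]; exact Submodule.smul_mem _ _ hx

lemma opT_AA {i i' : ℕ} {w w' : ℤ} {j : ℕ} {F} (hF : F ∈ AA i w) (hi : i' ≤ i + j)
    (hw : w + j = w') : opT j F ∈ AA i' w' := by
  refine Submodule.span_induction (p := fun F _ => opT j F ∈ AA i' w') ?_ (by simp) ?_ ?_ hF
  · rintro _ ⟨j', h, h1, h2, h3, h4, rfl⟩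
    refine Submodule.subset_span ⟨j + j', h, by omega, ?_, h3, h4, ?_⟩
    · omega
    · rw [opT_opT]
  · intro x y _ _ hx hy
    rw [map_add]; exact add_mem hx hy
  · intro c x _ hx
    rw [map_smul]; exact Submodule.smul_mem _ _ hx

/-- partial fractions. -/
lemma pfrac (K : ℕ) (u v t : ℚ) (h : u * v = t * (u + v)) :
    u ^ (K + 1) * v = (∑ i ∈ Finset.range K, t ^ (i + 1) * u ^ (K + 1 - i)) +
      t ^ (K + 1) * (u + v) := by
  induction K with
  | zero => simp [h]
  | succ K ih =>
    rw [Finset.sum_range_succ]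
    have : ∑ i ∈ Finset.range K, t ^ (i + 1) * u ^ (K + 1 + 1 - i) =
        u * ∑ i ∈ Finset.range K, t ^ (i + 1) * u ^ (K + 1 - i) := by
      rw [Finset.mul_sum]
      apply Finset.sum_congr rfl
      intro i hi
      have := Finset.mem_range.1 hi
      rw [show K + 1 + 1 - i = (K + 1 - i) + 1 by omega]
      ring
    rw [this, show K + 1 + 1 - K = 2 by omega]
    calc u ^ (K + 1 + 1) * v = u * (u ^ (K + 1) * v) := by ring
      _ = _ := by rw [ih]; linear_combination t ^ (K + 1) * h

lemma uv_rel {N m : ℕ} (h1 : 1 ≤ m) (h2 : m < N) :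
    (1 / (m : ℚ)) * (1 / ((N : ℚ) - m)) = (1 / (N : ℚ)) * (1 / (m : ℚ) + 1 / ((N : ℚ) - m)) := by
  have a : (m : ℚ) ≠ 0 := by positivity
  have b : (N : ℚ) ≠ 0 := by
    have : 0 < N := by omega
    positivity
  have c : (N : ℚ) - m ≠ 0 := by
    have : (m : ℚ) < N := by exact_mod_cast h2
    linarith
  field_simp
  ring

/-- `Σ_{m<n} u^k v q`. -/
lemma sum_pfrac (K : ℕ) (q : ℕ → ℕ → ℚ) (N n : ℕ) (hn : n ≤ N) :
    ∑ m ∈ Finset.Ico 1 n, (1 / (m : ℚ)) ^ (K + 1) * (1 / ((N : ℚ) - m)) * q N m =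
      (∑ i ∈ Finset.range K, opT (i + 1) (opX (K + 1 - i) q)) N n +
      (1 / (N : ℚ)) ^ (K + 1) *
        ∑ m ∈ Finset.Ico 1 n, (1 / (m : ℚ) + 1 / ((N : ℚ) - m)) * q N m := by
  have : (∑ i ∈ Finset.range K, opT (i + 1) (opX (K + 1 - i) q)) N n =
      ∑ m ∈ Finset.Ico 1 n, ∑ i ∈ Finset.range K,
        (1 / (N : ℚ)) ^ (i + 1) * (1 / (m : ℚ)) ^ (K + 1 - i) * q N m := by
    rw [Finset.sum_apply, Finset.sum_apply, Finset.sum_comm]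
    apply Finset.sum_congr rfl
    intro i hi
    have := Finset.mem_range.1 hi
    rw [opT_apply, opX_ge _ (by omega), Finset.mul_sum]
    apply Finset.sum_congr rfl
    intro m _
    rw [one_div_pow (m : ℚ)]; ring
  rw [this, Finset.mul_sum, ← Finset.sum_add_distrib]
  apply Finset.sum_congr rfl
  intro m hm
  have hm := Finset.mem_Ico.1 hm
  rw [pfrac K _ _ _ (uv_rel hm.1 (lt_of_lt_of_le hm.2 hn)), add_mul, Finset.sum_mul]
  ring

/-- The key commutation `E((1+x_1)h)`. -/
lemma E_one (h : ℕ → ℕ → ℚ) (N n : ℕ) (h1 : 1 ≤ n) (hn : n < N) :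
    ∑ m ∈ Finset.Ico 1 (n + 1), (1 / ((N : ℚ) + 1 - m) - 1 / ((N : ℚ) - m)) *
        (opX 1 h N m + h N m) =
      -(1 / ((N : ℚ) - n)) * opX 1 h N n + (1 / (N : ℚ)) * opX 1 h N n
        - (1 / (N : ℚ)) * (1 / ((N : ℚ) - n)) * h N n := by
  induction n, h1 using Nat.le_induction with
  | base =>
    have c : (N : ℚ) - 1 ≠ 0 := by
      have : (1 : ℚ) < N := by exact_mod_cast hn
      linarith
    have b : (N : ℚ) ≠ 0 := by
      have : 0 < N := by omega
      positivity
    simp [opX_one]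
    field_simp
    ring
  | succ n h1 ih =>
    rw [Finset.sum_Ico_succ_top (by omega), ih (by omega)]
    have e : opX 1 h N (n + 1) = opX 1 h N n + 1 / (n : ℚ) * h N n +
        1 / ((N : ℚ) - (n + 1 : ℕ)) * h N (n + 1) := by
      rw [opX_one, opX_one, Finset.sum_Ico_succ_top (by omega),
        Finset.sum_Ico_succ_top (b := n + 1) (by omega)]
      ring
    rw [e]
    generalize opX 1 h N n = A
    generalize h N n = B
    generalize h N (n + 1) = C
    have hN : (n : ℚ) + 1 < N := by exact_mod_cast hn
    have c : (N : ℚ) - n ≠ 0 := by linarith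
    have c' : (N : ℚ) - (n + 1) ≠ 0 := by linarith
    have c2 : (N : ℚ) - n - 1 ≠ 0 := by linarith
    have c3 : (N : ℚ) + 1 - (n + 1) ≠ 0 := by linarith
    have a : (n : ℚ) ≠ 0 := by positivity
    have b : (N : ℚ) ≠ 0 := by
      have : 0 < N := by omega
      positivity
    push_cast
    field_simp
    ring

lemma E_adm (w : ℤ) (r : ℕ → ℕ → ℚ) (hr : r ∈ AA 0 w) :
    ∃ ε ρ : ℕ → ℕ → ℚ, ε ∈ AA 0 (w + 1) ∧ ρ ∈ PP 2 w ∧ ε - opT 1 r ∈ PP 2 (w + 1) ∧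
      (∀ N n : ℕ, 1 ≤ n → n < N →
        ∑ m ∈ Finset.Ico 1 (n + 1), (1 / ((N : ℚ) + 1 - m) - 1 / ((N : ℚ) - m)) * r N m =
          -(1 / ((N : ℚ) - n)) * r N n + ε N n + opX 1 ρ N n - (1 / ((N : ℚ) - n)) * ρ N n) ∧
      (∀ N : ℕ, 1 ≤ N →
        ∑ m ∈ Finset.Ico 1 N, (1 / ((N : ℚ) + 1 - m) - 1 / ((N : ℚ) - m)) * r N m -
          ∑ m ∈ Finset.Ico 1 N, (1 / (m : ℚ) + 1 / ((N : ℚ) - m)) * ρ N m =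
          ε N N - r N N) := by
  refine Submodule.span_induction (p := fun r _ => ∃ ε ρ : ℕ → ℕ → ℚ, ε ∈ AA 0 (w + 1) ∧
      ρ ∈ PP 2 w ∧ ε - opT 1 r ∈ PP 2 (w + 1) ∧
      (∀ N n : ℕ, 1 ≤ n → n < N →
        ∑ m ∈ Finset.Ico 1 (n + 1), (1 / ((N : ℚ) + 1 - m) - 1 / ((N : ℚ) - m)) * r N m =
          -(1 / ((N : ℚ) - n)) * r N n + ε N n + opX 1 ρ N n - (1 / ((N : ℚ) - n)) * ρ N n) ∧
      (∀ N : ℕ, 1 ≤ N →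
        ∑ m ∈ Finset.Ico 1 N, (1 / ((N : ℚ) + 1 - m) - 1 / ((N : ℚ) - m)) * r N m -
          ∑ m ∈ Finset.Ico 1 N, (1 / (m : ℚ) + 1 / ((N : ℚ) - m)) * ρ N m =
          ε N N - r N N)) ?_ ?_ ?_ ?_ hr
  · rintro _ ⟨j, h, -, h2, h3, h4, rfl⟩
    -- telescoping for the constant function
    have tel : ∀ N n : ℕ, 1 ≤ n → n < N →
        ∑ m ∈ Finset.Ico 1 (n + 1), (1 / ((N : ℚ) + 1 - m) - 1 / ((N : ℚ) - m)) =
        1 / (N : ℚ) - 1 / ((N : ℚ) - n) := by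
      intro N n h1 hn
      induction n, h1 using Nat.le_induction with
      | base => simp
      | succ n h1 ih =>
        rw [Finset.sum_Ico_succ_top (by omega), ih (by omega)]
        push_cast
        rw [show (N : ℚ) + 1 - (n + 1) = N - n by ring]
        ring
    cases h with
    | nil =>
      refine ⟨opT (j + 1) (wrd []), 0, ?_, by simp, ?_, ?_, ?_⟩
      · exact Submodule.subset_span ⟨j + 1, [], by omega, by push_cast; simp at h2; simp; omega,
          by simp, by simp, rfl⟩
      · rw [opT_opT, add_comm 1 j, sub_self]; simp
      · intro N n h1 hn
        simp only [opT_apply, wrd, ← Finset.sum_mul, tel N n h1 hn, map_zero, Pi.zero_apply]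
        ring
      · intro N hN
        rcases Nat.eq_or_lt_of_le hN with rfl | hN
        · simp [opT_apply, wrd]
        · obtain ⟨n, rfl⟩ : ∃ n, N = n + 1 := ⟨N - 1, by omega⟩
          simp only [opT_apply, wrd, ← Finset.sum_mul, tel (n + 1) n (by omega) (by omega),
            Pi.zero_apply, mul_zero, Finset.sum_const_zero, pow_succ]
          rw [show (((n + 1 : ℕ) : ℚ) - n) = 1 by push_cast; ring]
          ring
    | cons k h =>
      have hk : 2 ≤ k := by simpa using h4
      obtain ⟨K, rfl⟩ : ∃ K, k = K + 1 := ⟨k - 1, by omega⟩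
      have hh : opT j (wrd h) ∈ PP 0 (w - (K + 1 : ℕ)) := by
        refine Submodule.subset_span ⟨j, h, by omega, ?_, ?_, rfl⟩
        · simp only [List.sum_cons] at h2; omega
        · intro x hx; exact h3 x (by simp [hx])
      have e0 : opT j (wrd ((K + 1) :: h)) = opX (K + 1) (opT j (wrd h)) := by
        rw [opX_opT]; rfl
      rw [e0]
      generalize opT j (wrd h) = g at hh
      have key : ∀ N n : ℕ, 1 ≤ n → n ≤ N →
          ∑ m ∈ Finset.Ico 1 n, (1 / ((N : ℚ) + 1 - m) - 1 / ((N : ℚ) - m)) *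
            opX (K + 1) g N m =
          - (1 / ((N : ℚ) + 1 - n)) * opX (K + 1) g N n +
          ∑ m ∈ Finset.Ico 1 n, (1 / (m : ℚ)) ^ (K + 1) * (1 / ((N : ℚ) - m)) * g N m := by
        intro N n h1 hn
        induction n, h1 using Nat.le_induction with
        | base => simp [opX_ge _ hk]
        | succ n h1 ih =>
          rw [Finset.sum_Ico_succ_top (by omega), Finset.sum_Ico_succ_top (by omega),
            ih (by omega)]
          have e : opX (K + 1) g N (n + 1) = opX (K + 1) g N n +
              (1 / (n : ℚ)) ^ (K + 1) * g N n := by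
            rw [opX_ge _ hk, opX_ge _ hk, Finset.sum_Ico_succ_top (by omega), one_div_pow]
          rw [e]
          push_cast
          rw [show (N : ℚ) + 1 - (n + 1) = N - n by ring]
          ring
      refine ⟨∑ i ∈ Finset.range K, opT (i + 1) (opX (K + 1 - i) g), opT (K + 1) g,
        ?_, ?_, ?_, ?_, ?_⟩
      · apply Submodule.sum_mem
        intro i hi
        have := Finset.mem_range.1 hi
        refine opT_AA (opX_AA (by omega) hh rfl) (by omega) ?_
        omega
      · exact opT_PP hh (by omega) (by omega)
      · obtain ⟨L, rfl⟩ : ∃ L, K = L + 1 := ⟨K - 1, by omega⟩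
        rw [Finset.sum_range_succ']
        simp only [zero_add, Nat.sub_zero, add_sub_cancel_right]
        apply Submodule.sum_mem
        intro i hi
        have := Finset.mem_range.1 hi
        refine opT_PP (opX_PP (by omega) hh rfl) (by omega) ?_
        omega
      · intro N n h1 hn
        rw [Finset.sum_Ico_succ_top (by omega), key N n h1 hn.le, sum_pfrac K g N n hn.le,
          opX_opT, opT_apply, opT_apply, opX_one, Finset.sum_Ico_succ_top (by omega)]
        simp only [add_mul, Finset.sum_add_distrib]
        ring
      · intro N hN
        rw [key N N hN le_rfl, sum_pfrac K g N N le_rfl]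
        simp only [opT_apply, mul_left_comm _ ((1 / (N : ℚ)) ^ (K + 1)), ← Finset.mul_sum]
        simp
        ring
  · exact ⟨0, 0, by simp, by simp, by simp, by simp, by simp⟩
  · rintro x y - - ⟨ε, ρ, a1, a2, a3, a4, a5⟩ ⟨ε', ρ', b1, b2, b3, b4, b5⟩
    refine ⟨ε + ε', ρ + ρ', add_mem a1 b1, add_mem a2 b2, ?_, ?_, ?_⟩
    · rw [map_add, show ε + ε' - (opT 1 x + opT 1 y) = (ε - opT 1 x) + (ε' - opT 1 y) by abel]
      exact add_mem a3 b3
    · intro N n h1 hn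
      simp only [Pi.add_apply, mul_add, Finset.sum_add_distrib, map_add, a4 N n h1 hn,
        b4 N n h1 hn]
      ring
    · intro N hN
      simp only [Pi.add_apply, mul_add, Finset.sum_add_distrib]
      linear_combination a5 N hN + b5 N hN
  · rintro c x - ⟨ε, ρ, a1, a2, a3, a4, a5⟩
    refine ⟨c • ε, c • ρ, Submodule.smul_mem _ _ a1, Submodule.smul_mem _ _ a2, ?_, ?_, ?_⟩
    · rw [map_smul, ← smul_sub]
      exact Submodule.smul_mem _ _ a3
    · intro N n h1 hn
      simp only [Pi.smul_apply, smul_eq_mul, mul_left_comm _ c, ← Finset.mul_sum, map_smul,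
        a4 N n h1 hn]
      ring
    · intro N hN
      simp only [Pi.smul_apply, smul_eq_mul, mul_left_comm _ c, ← Finset.mul_sum]
      linear_combination c * a5 N hN

def Good (w : ℤ) (f : ℕ → ℕ → ℚ) (q R : ℕ → ℕ → ℚ) : Prop :=
  q ∈ PP 0 (w - 1) ∧ R ∈ AA 0 w ∧
  (∀ N n : ℕ, 1 ≤ n → n < N →
    f (N + 1) n = opX 1 q N n + R N n - (1 / ((N : ℚ) - n)) * q N n) ∧
  (∀ N : ℕ, 1 ≤ N → f (N + 1) N -
    ∑ m ∈ Finset.Ico 1 N, (1 / (m : ℚ) + 1 / ((N : ℚ) - m)) * q N m = R N N) ∧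
  (opX 1 q + R - f - opT 1 q ∈ PP 2 w)

lemma good_nil : Good 0 (wrd []) 0 (wrd []) := by
  refine ⟨by simp, ?_, ?_, ?_, ?_⟩
  · exact Submodule.subset_span ⟨0, [], le_rfl, by simp, by simp, by simp, (opT_zero _).symm⟩
  · intro N n _ _
    simp [wrd]
  · intro N _
    simp [wrd]
  · simp

lemma good_step {w w' : ℤ} {f q R : ℕ → ℕ → ℚ} (H : Good w f q R) (K : ℕ) (hK : 1 ≤ K)
    (hw : w + (K + 1 : ℕ) = w') :
    ∃ q' R' : ℕ → ℕ → ℚ, Good w' (opX (K + 1) f) q' R' ∧ R' - opX (K + 1) f ∈ AA 2 w' ∧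
      q' = - opT (K + 1) q := by
  obtain ⟨h1, h2, h3, h4, h5⟩ := H
  have hk : 2 ≤ K + 1 := by omega
  have hP : opX 1 q + R ∈ PP 0 w :=
    add_mem (opX_PP le_rfl h1 (by simp)) (AA_le_PP _ _ h2)
  have hq' : opT (K + 1) q ∈ PP (K + 1) (w' - 1) := opT_PP h1 (by omega) (by omega)
  have hR : opX (K + 1) (opX 1 q + R) -
      ∑ i ∈ Finset.range K, opT (i + 1) (opX (K + 1 - i) q) - opX (K + 1) f ∈ AA 2 w' := by
    obtain ⟨L, rfl⟩ : ∃ L, K = L + 1 := ⟨K - 1, by omega⟩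
    rw [Finset.sum_range_succ']
    have a : opX (L + 1 + 1) (opX 1 q + R - f - opT 1 q) ∈ AA 2 w' := opX_AA hk h5 hw
    have b : ∑ i ∈ Finset.range L, opT (i + 1 + 1) (opX (L + 1 + 1 - (i + 1)) q) ∈ AA 2 w' := by
      apply Submodule.sum_mem
      intro i hi
      have := Finset.mem_range.1 hi
      exact opT_AA (opX_AA (by omega) h1 rfl) (by omega) (by omega)
    convert sub_mem a b using 1
    simp only [map_sub, map_add, opX_opT, zero_add, Nat.sub_zero]
    abel
  have key : ∀ N n : ℕ, 1 ≤ n → n ≤ N → opX (K + 1) f (N + 1) n =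
      (opX (K + 1) (opX 1 q + R) - ∑ i ∈ Finset.range K, opT (i + 1) (opX (K + 1 - i) q)) N n -
      (1 / (N : ℚ)) ^ (K + 1) *
        ∑ m ∈ Finset.Ico 1 n, (1 / (m : ℚ) + 1 / ((N : ℚ) - m)) * q N m := by
    intro N n hn hN
    have := sum_pfrac K q N n hN
    simp only [Pi.sub_apply]
    rw [sub_sub, ← this, opX_ge _ hk, opX_ge _ hk, ← Finset.sum_sub_distrib]
    apply Finset.sum_congr rfl
    intro m hm
    have hm := Finset.mem_Ico.1 hm
    rw [h3 N m hm.1 (by omega), one_div_pow]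
    simp only [Pi.add_apply]
    ring
  refine ⟨- opT (K + 1) q, opX (K + 1) (opX 1 q + R) -
      ∑ i ∈ Finset.range K, opT (i + 1) (opX (K + 1 - i) q),
      ⟨?_, ?_, ?_, ?_, ?_⟩, hR, rfl⟩
  · exact neg_mem (PP_mono (by omega) _ hq')
  · refine sub_mem (opX_AA hk hP hw) (Submodule.sum_mem _ ?_)
    intro i hi
    have := Finset.mem_range.1 hi
    exact opT_AA (opX_AA (by omega) h1 rfl) (by omega) (by omega)
  · intro N n hn hN
    rw [key N n hn hN.le, map_neg, opX_opT]
    simp only [Pi.neg_apply, opT_apply]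
    rw [opX_one, Finset.sum_Ico_succ_top (by omega)]
    simp only [add_mul, Finset.sum_add_distrib]
    ring
  · intro N hN
    rw [key N N hN le_rfl]
    simp only [Pi.neg_apply, opT_apply, mul_neg, mul_left_comm _ ((1 / (N : ℚ)) ^ (K + 1)),
      ← Finset.mul_sum, Finset.sum_neg_distrib]
    ring
  · have a : opX 1 (opT (K + 1) q) ∈ PP 2 w' :=
      opX_PP le_rfl (PP_mono hk _ hq') (by simp)
    have b : opT 1 (opT (K + 1) q) ∈ PP 2 w' := opT_PP hq' (by omega) (by simp)
    convert add_mem (sub_mem (AA_le_PP _ _ hR) a) b using 1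
    simp only [map_neg]
    abel

lemma good_step_one {w w' : ℤ} {f q R : ℕ → ℕ → ℚ} (H : Good w f q R) (hw : w + 1 = w') :
    ∃ q' R' : ℕ → ℕ → ℚ, Good w' (opX 1 f) q' R' := by
  subst hw
  obtain ⟨h1, h2, h3, h4, h5⟩ := H
  obtain ⟨ε, ρ, e1, e2, e3, e4, e5⟩ := E_adm w R h2
  have hP : opX 1 q + R ∈ PP 0 w :=
    add_mem (opX_PP le_rfl h1 (by simp)) (AA_le_PP _ _ h2)
  refine ⟨opX 1 q + R + ρ, ε, ?_, e1, ?_, ?_, ?_⟩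
  · rw [add_sub_cancel_right]
    exact add_mem hP (PP_mono (by omega) _ e2)
  · intro N n hn hN
    have E1 := E_one q N n hn hN
    have E4 := e4 N n hn hN
    have lhs : opX 1 f (N + 1) n =
        opX 1 (opX 1 q + R) N n
        - (1 / (N : ℚ)) * ∑ m ∈ Finset.Ico 1 n, (1 / (m : ℚ) + 1 / ((N : ℚ) - m)) * q N m
        + ∑ m ∈ Finset.Ico 1 (n + 1), (1 / ((N : ℚ) + 1 - m) - 1 / ((N : ℚ) - m)) *
        (opX 1 q N m + q N m) +
        ∑ m ∈ Finset.Ico 1 (n + 1), (1 / ((N : ℚ) + 1 - m) - 1 / ((N : ℚ) - m)) * R N m := by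
      rw [opX_one, opX_one, Finset.mul_sum]
      have A : ∑ m ∈ Finset.Ico 1 n, 1 / (m : ℚ) * f (N + 1) m =
          ∑ m ∈ Finset.Ico 1 n, 1 / (m : ℚ) * (opX 1 q + R) N m -
          ∑ m ∈ Finset.Ico 1 n, 1 / (N : ℚ) * ((1 / (m : ℚ) + 1 / ((N : ℚ) - m)) * q N m) := by
        rw [← Finset.sum_sub_distrib]
        apply Finset.sum_congr rfl
        intro m hm
        have hm := Finset.mem_Ico.1 hm
        rw [h3 N m hm.1 (by omega)]
        simp only [Pi.add_apply]
        linear_combination (- q N m) * uv_rel hm.1 (show m < N by omega)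
      have B : ∑ m ∈ Finset.Ico 1 (n + 1), 1 / (((N + 1 : ℕ) : ℚ) - m) * f (N + 1) m =
          ∑ m ∈ Finset.Ico 1 (n + 1), 1 / ((N : ℚ) - m) * (opX 1 q + R) N m +
          ∑ m ∈ Finset.Ico 1 (n + 1), (1 / ((N : ℚ) + 1 - m) - 1 / ((N : ℚ) - m)) *
            (opX 1 q N m + q N m) +
          ∑ m ∈ Finset.Ico 1 (n + 1), (1 / ((N : ℚ) + 1 - m) - 1 / ((N : ℚ) - m)) * R N m := by
        rw [← Finset.sum_add_distrib, ← Finset.sum_add_distrib]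
        apply Finset.sum_congr rfl
        intro m hm
        have hm := Finset.mem_Ico.1 hm
        rw [h3 N m hm.1 (by omega)]
        simp only [Pi.add_apply]
        have hN : (m : ℚ) < N := by
          have : m < N := by omega
          exact_mod_cast this
        have c : (N : ℚ) - m ≠ 0 := by linarith
        have c3 : (N : ℚ) + 1 - m ≠ 0 := by linarith
        push_cast
        field_simp
        ring
      rw [A, B]
      ring
    rw [lhs, E1, E4]
    simp only [map_add, Pi.add_apply]
    rw [opX_one q, Finset.sum_Ico_succ_top (by omega)]
    simp only [add_mul, Finset.sum_add_distrib]
    ring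
  · intro N hN
    have E5 := e5 N hN
    have H4 := h4 N hN
    have E2 : ∑ m ∈ Finset.Ico 1 N, (1 / ((N : ℚ) + 1 - m) - 1 / ((N : ℚ) - m)) *
        (opX 1 q N m + q N m) = - (1 - 1 / (N : ℚ)) *
          ∑ m ∈ Finset.Ico 1 N, (1 / (m : ℚ) + 1 / ((N : ℚ) - m)) * q N m := by
      rcases Nat.eq_or_lt_of_le hN with rfl | hN'
      · simp
      · obtain ⟨n, rfl⟩ : ∃ n, N = n + 1 := ⟨N - 1, by omega⟩
        have hn : 1 ≤ n := by omega
        rw [E_one q (n + 1) n hn (by omega), opX_one]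
        have a : (n : ℚ) ≠ 0 := by positivity
        have b : (n : ℚ) + 1 ≠ 0 := by positivity
        have x1 : (((n + 1 : ℕ) : ℚ) - n) = 1 := by push_cast; ring
        simp only [add_mul, Finset.sum_add_distrib]
        rw [Finset.sum_Ico_succ_top hn (fun m : ℕ => 1 / (m : ℚ) * q (n + 1) m), x1]
        push_cast
        field_simp
        ring
    have lhs : opX 1 f (N + 1) N = f (N + 1) N +
        ∑ m ∈ Finset.Ico 1 N, (1 / (m : ℚ) + 1 / ((N : ℚ) - m)) * (opX 1 q + R) N m
        - (1 / (N : ℚ)) * ∑ m ∈ Finset.Ico 1 N, (1 / (m : ℚ) + 1 / ((N : ℚ) - m)) * q N m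
        + ∑ m ∈ Finset.Ico 1 N, (1 / ((N : ℚ) + 1 - m) - 1 / ((N : ℚ) - m)) *
        (opX 1 q N m + q N m) +
        ∑ m ∈ Finset.Ico 1 N, (1 / ((N : ℚ) + 1 - m) - 1 / ((N : ℚ) - m)) * R N m := by
      rw [opX_one, Finset.sum_Ico_succ_top (by omega), Finset.mul_sum]
      have x1 : 1 / (((N + 1 : ℕ) : ℚ) - N) = 1 := by push_cast; simp
      rw [x1, ← add_assoc, ← Finset.sum_add_distrib, one_mul, add_comm]
      rw [add_sub_assoc, ← Finset.sum_sub_distrib, add_assoc, add_assoc, ← Finset.sum_add_distrib,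
        ← Finset.sum_add_distrib]
      congr 1
      apply Finset.sum_congr rfl
      intro m hm
      have hm := Finset.mem_Ico.1 hm
      rw [h3 N m hm.1 (by omega)]
      simp only [Pi.add_apply]
      have hN : (m : ℚ) < N := by exact_mod_cast hm.2
      have c : (N : ℚ) - m ≠ 0 := by linarith
      have c3 : (N : ℚ) + 1 - m ≠ 0 := by linarith
      have c4 : (m : ℚ) ≠ 0 := by
        have := hm.1
        positivity
      have c5 : (N : ℚ) ≠ 0 := by positivity
      push_cast
      field_simp
      ring
    rw [lhs, E2]
    simp only [Pi.add_apply, mul_add, Finset.sum_add_distrib] at *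
    linear_combination E5 + H4
  · have a : opX 1 (opX 1 q + R - f - opT 1 q) ∈ PP 2 (w + 1) := opX_PP le_rfl h5 (by simp)
    have b : opX 1 ρ ∈ PP 2 (w + 1) := opX_PP le_rfl e2 (by simp)
    have c : opT 1 ρ ∈ PP 2 (w + 1) := opT_PP e2 (by omega) (by simp)
    convert sub_mem (add_mem (add_mem a b) e3) c using 1
    simp only [map_sub, map_add, opX_opT]
    abel

lemma good_exists (h : List ℕ) (hh : ∀ x ∈ h, 1 ≤ x) :
    ∃ q R : ℕ → ℕ → ℚ, Good (h.sum : ℕ) (wrd h) q R := by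
  induction h with
  | nil => exact ⟨_, _, good_nil⟩
  | cons k h ih =>
    obtain ⟨q, R, H⟩ := ih (fun x hx => hh x (by simp [hx]))
    have hk := hh k (by simp)
    rcases Nat.eq_or_lt_of_le hk with rfl | hk
    · exact good_step_one H (by simp only [List.sum_cons]; omega)
    · obtain ⟨K, rfl⟩ : ∃ K, k = K + 1 := ⟨k - 1, by omega⟩
      obtain ⟨q', R', H', -⟩ := good_step H K (by omega)
        (w' := ((((K + 1) :: h).sum : ℕ) : ℤ)) (by simp only [List.sum_cons]; omega)
      exact ⟨q', R', H'⟩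

lemma wrd_diff (k : ℕ) (hk : 2 ≤ k) (h : List ℕ) (hh : ∀ x ∈ h, 1 ≤ x) :
    ∃ G ∈ AA 2 ((k :: h).sum : ℕ), ∀ N : ℕ, 1 ≤ N →
      wrd (k :: h) (N + 1) (N + 1) - wrd (k :: h) N N = G N N := by
  obtain ⟨q, R, H⟩ := good_exists h hh
  obtain ⟨K, rfl⟩ : ∃ K, k = K + 1 := ⟨k - 1, by omega⟩
  obtain ⟨q', R', H', hR', rfl⟩ := good_step H K (by omega) rfl
  have e : ((((K + 1) :: h).sum : ℕ) : ℤ) = (h.sum : ℕ) + (K + 1 : ℕ) := by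
    simp only [List.sum_cons]; omega
  refine ⟨(R' - opX (K + 1) (wrd h)) + opT (K + 1) R, ?_, ?_⟩
  · rw [e]
    exact add_mem hR' (opT_AA H.2.1 (by omega) rfl)
  · intro N hN
    have a := H'.2.2.2.1 N hN
    have b := H.2.2.2.1 N hN
    have c : wrd ((K + 1) :: h) (N + 1) (N + 1) = wrd ((K + 1) :: h) (N + 1) N +
        (1 / (N : ℚ)) ^ (K + 1) * wrd h (N + 1) N := by
      simp only [wrd]
      rw [opX_ge _ hk, opX_ge _ hk, Finset.sum_Ico_succ_top (by omega), one_div_pow]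
    rw [c]
    simp only [Pi.add_apply, Pi.sub_apply, opT_apply, ← b, ← a, wrd]
    simp only [Pi.neg_apply, opT_apply, mul_neg, mul_left_comm _ ((1 / (N : ℚ)) ^ (K + 1)),
      ← Finset.mul_sum, Finset.sum_neg_distrib]
    ring

/-- ordinary multiple harmonic sums, outermost entry first. -/
noncomputable def zz : List ℕ → ℕ → ℚ
  | [] => fun _ => 1
  | k :: h => fun n => ∑ m ∈ Finset.Ico 1 n, (1 / (m : ℚ) ^ k) * zz h m

lemma zz_succ (k : ℕ) (h : List ℕ) (n : ℕ) (hn : 1 ≤ n) :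
    zz (k :: h) (n + 1) = zz (k :: h) n + (1 / (n : ℚ) ^ k) * zz h n := by
  simp only [zz]
  rw [Finset.sum_Ico_succ_top hn]

lemma wrd_eq_zz (h : List ℕ) (hh : ∀ x ∈ h, 2 ≤ x) (N n : ℕ) : wrd h N n = zz h n := by
  induction h generalizing n with
  | nil => rfl
  | cons k h ih =>
    simp only [wrd, zz]
    rw [opX_ge _ (hh k (by simp))]
    apply Finset.sum_congr rfl
    intro m _
    rw [ih (fun x hx => hh x (by simp [hx]))]

noncomputable def BB (w : ℕ) : Submodule ℚ (ℕ+ → ℚ) :=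
  Submodule.span ℚ {x | ∃ l : List ℕ, l.sum = w ∧ (∀ x ∈ l, 2 ≤ x) ∧
    x = fun N : ℕ+ => zz l N}

lemma BB_lift (w j : ℕ) (hj : 2 ≤ j) (b : ℕ+ → ℚ) (hb : b ∈ BB w) :
    ∃ s ∈ BB (w + j), s 1 = 0 ∧ ∀ N : ℕ+, s (N + 1) - s N = (1 / (N : ℚ)) ^ j * b N := by
  refine Submodule.span_induction (p := fun b _ => ∃ s ∈ BB (w + j), s 1 = 0 ∧
    ∀ N : ℕ+, s (N + 1) - s N = (1 / (N : ℚ)) ^ j * b N) ?_ ?_ ?_ ?_ hb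
  · rintro _ ⟨l, h1, h2, rfl⟩
    refine ⟨_, Submodule.subset_span ⟨j :: l, ?_, ?_, rfl⟩, ?_, ?_⟩
    · simp [h1, add_comm]
    · simpa using ⟨hj, h2⟩
    · simp [zz]
    · intro N
      have := zz_succ j l N N.2
      rw [PNat.add_coe, PNat.one_coe, this, one_div_pow]
      ring
  · exact ⟨0, by simp, by simp, by simp⟩
  · rintro x y - - ⟨s, a1, a2, a3⟩ ⟨s', b1, b2, b3⟩
    refine ⟨s + s', add_mem a1 b1, by simp [a2, b2], ?_⟩
    intro N
    simp only [Pi.add_apply]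
    linear_combination a3 N + b3 N
  · rintro c x - ⟨s, a1, a2, a3⟩
    refine ⟨c • s, Submodule.smul_mem _ _ a1, by simp [a2], ?_⟩
    intro N
    simp only [Pi.smul_apply, smul_eq_mul]
    linear_combination c * a3 N

lemma wrd_mem_BB (w : ℕ) : ∀ h : List ℕ, h.sum = w → (∀ x ∈ h, 1 ≤ x) →
    (∀ x ∈ h.head?, 2 ≤ x) → (fun N : ℕ+ => wrd h N N) ∈ BB w := by
  induction w using Nat.strong_induction_on with
  | _ w ih =>
  intro h hw hh hhd
  cases h with
  | nil =>
    refine Submodule.subset_span ⟨[], hw, by simp, rfl⟩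
  | cons k h =>
    have hk : 2 ≤ k := by simpa using hhd
    obtain ⟨G, hG, hd⟩ := wrd_diff k hk h (fun x hx => hh x (by simp [hx]))
    rw [hw] at hG
    have : ∃ s ∈ BB w, s 1 = 0 ∧ ∀ N : ℕ+, s (N + 1) - s N = G N N := by
      refine Submodule.span_induction (p := fun G _ => ∃ s ∈ BB w, s 1 = 0 ∧
        ∀ N : ℕ+, s (N + 1) - s N = G N N) ?_ ?_ ?_ ?_ hG
      · rintro _ ⟨j, l, h1, h2, h3, h4, rfl⟩
        obtain ⟨s, s1, s2, s3⟩ := BB_lift _ j h1 _ (ih l.sum (by omega) l rfl h3 h4)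
        refine ⟨s, ?_, s2, s3⟩
        convert s1
        omega
      · exact ⟨0, by simp, by simp, by simp⟩
      · rintro x y - - ⟨s, a1, a2, a3⟩ ⟨s', b1, b2, b3⟩
        refine ⟨s + s', add_mem a1 b1, by simp [a2, b2], ?_⟩
        intro N
        simp only [Pi.add_apply]
        linear_combination a3 N + b3 N
      · rintro c x - ⟨s, a1, a2, a3⟩
        refine ⟨c • s, Submodule.smul_mem _ _ a1, by simp [a2], ?_⟩
        intro N
        simp only [Pi.smul_apply, smul_eq_mul]
        linear_combination c * a3 N
    obtain ⟨s, s1, s2, s3⟩ := this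
    convert s1 using 1
    funext N
    induction N using PNat.recOn with
    | one =>
      rw [s2]
      simp [wrd, opX_ge _ hk]
    | succ N ihN =>
      have := s3 N
      rw [← hd N N.2] at this
      rw [PNat.add_coe, PNat.one_coe]
      linear_combination ihN - this

/-- transfer kernel. -/
noncomputable def zker (N k m x : ℕ) : ℚ :=
  (if k = 1 ∧ 0 < m ∧ m ≤ x then 1 / ((N : ℚ) - m) else 0) +
    (if 0 < m ∧ m < x then 1 / (m : ℚ) ^ k else 0)

/-- the position following `i`. -/
def znxt (N : ℕ) {r : ℕ} (n : Fin r → Fin N) (i : Fin r) : ℕ :=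
  if h : (i : ℕ) + 1 < r then n ⟨(i : ℕ) + 1, h⟩ else N

def zfst (N : ℕ) {r : ℕ} (n : Fin r → Fin N) : ℕ :=
  if h : 0 < r then n ⟨0, h⟩ else N

lemma zdiaL_eq (N : ℕ) (k : List ℕ) : zdiaL N k =
    ∑ n : Fin k.length → Fin N, ∏ i : Fin k.length, zker N (k.get i) (n i) (znxt N n i) := by
  unfold zdiaL zker
  simp_rw [Finset.prod_add, Finset.powerset_univ]
  rw [Finset.sum_comm]
  apply Finset.sum_congr rfl
  intro A _
  have hs : ∀ n : Fin k.length → Fin N, (∏ i ∈ A, (if k.get i = 1 ∧ 0 < (n i : ℕ) ∧ (n i : ℕ) ≤ znxt N n i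
      then 1 / ((N : ℚ) - (n i : ℕ)) else 0)) *
      (∏ i ∈ Finset.univ \ A, (if 0 < (n i : ℕ) ∧ (n i : ℕ) < znxt N n i
      then 1 / ((n i : ℕ) : ℚ) ^ k.get i else 0)) =
      ∏ i, (if (i ∈ A → k.get i = 1) ∧ 0 < (n i : ℕ) ∧
          (if i ∈ A then (n i : ℕ) ≤ znxt N n i else (n i : ℕ) < znxt N n i) then
        (if i ∈ A then 1 / ((N : ℚ) - (n i : ℕ)) else 1 / ((n i : ℕ) : ℚ) ^ k.get i) else 0) := by
    intro n
    rw [← Finset.prod_sdiff (Finset.subset_univ A), mul_comm]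
    congr 1
    · apply Finset.prod_congr rfl
      intro i hi
      have : i ∉ A := by simpa using hi
      simp [this]
    · apply Finset.prod_congr rfl
      intro i hi
      simp [hi]
  simp_rw [hs]
  have hp : ∀ n : Fin k.length → Fin N,
      (∏ i, (if (i ∈ A → k.get i = 1) ∧ 0 < (n i : ℕ) ∧
          (if i ∈ A then (n i : ℕ) ≤ znxt N n i else (n i : ℕ) < znxt N n i) then
        (if i ∈ A then 1 / ((N : ℚ) - (n i : ℕ)) else 1 / ((n i : ℕ) : ℚ) ^ k.get i) else 0)) =
      if (∀ i, (i ∈ A → k.get i = 1) ∧ 0 < (n i : ℕ) ∧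
          (if i ∈ A then (n i : ℕ) ≤ znxt N n i else (n i : ℕ) < znxt N n i)) then
      ∏ i, (if i ∈ A then 1 / ((N : ℚ) - (n i : ℕ)) else 1 / ((n i : ℕ) : ℚ) ^ k.get i) else 0 := by
    intro n
    split_ifs with h
    · apply Finset.prod_congr rfl
      intro i _
      rw [if_pos (h i)]
    · push Not at h
      obtain ⟨i, hi⟩ := h
      apply Finset.prod_eq_zero (Finset.mem_univ i)
      rw [if_neg]
      tauto
  simp_rw [hp]
  split_ifs with hA
  · rw [Finset.sum_filter]
    apply Finset.sum_congr rfl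
    intro n _
    congr 1
    rw [eq_iff_iff]
    constructor
    · rintro ⟨h1, h2⟩ i
      refine ⟨fun hi => hA i hi, h1 i, ?_⟩
      unfold znxt
      by_cases h : (i : ℕ) + 1 < k.length
      · simpa [h] using h2 i h
      · simp [h, (n i).2.le]
    · intro h
      refine ⟨fun i => (h i).2.1, ?_⟩
      intro i hi
      have := (h i).2.2
      unfold znxt at this
      simpa [hi] using this
  · symm
    apply Finset.sum_eq_zero
    intro n _
    rw [if_neg]
    intro h
    exact hA fun i hi => (h i).1 hi

noncomputable def TT (N : ℕ) (k : List ℕ) (φ : ℕ → ℚ) : ℚ :=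
  ∑ n : Fin k.length → Fin N, φ (zfst N n) *
    ∏ i : Fin k.length, zker N (k.get i) (n i) (znxt N n i)

lemma TT_cons (N k : ℕ) (l : List ℕ) (φ : ℕ → ℚ) :
    TT N (k :: l) φ = TT N l (fun x => ∑ m : Fin N, zker N k m x * φ m) := by
  unfold TT
  have := Fintype.sum_equiv (Fin.consEquiv (fun _ : Fin (l.length + 1) => Fin N))
    (fun p => φ p.1 * (zker N k p.1 (zfst N p.2) *
      ∏ i : Fin l.length, zker N (l.get i) (p.2 i) (znxt N p.2 i)))
    (fun n : Fin (l.length + 1) → Fin N => φ (zfst N n) *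
    ∏ i : Fin (l.length + 1), zker N ((k :: l).get i) (n i) (znxt N n i)) (by
      rintro ⟨a, n⟩
      rw [Fin.prod_univ_succ]
      congr 1
      congr 1
      · simp only [Fin.consEquiv, Equiv.coe_fn_mk, Fin.cons_zero]
        unfold zfst znxt
        by_cases h : 0 < l.length
        · simp [h]
          rfl
        · simp [h]
      · apply Finset.prod_congr rfl
        intro i _
        simp only [Fin.consEquiv, Equiv.coe_fn_mk, Fin.cons_succ]
        unfold znxt
        by_cases h : (i : ℕ) + 1 < l.length
        · simp [h]
          rfl
        · simp [h])
  refine this.symm.trans ?_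
  rw [Fintype.sum_prod_type, Finset.sum_comm]
  apply Finset.sum_congr rfl
  intro n _
  rw [Finset.sum_mul]
  apply Finset.sum_congr rfl
  intro m _
  ring

lemma ker_wrd (N k x : ℕ) (h : List ℕ) (hx : x ≤ N) :
    ∑ m : Fin N, zker N k m x * wrd h N m = wrd (k :: h) N x := by
  rw [Fin.sum_univ_eq_sum_range (fun m => zker N k m x * wrd h N m) N]
  simp only [zker, add_mul, Finset.sum_add_distrib, ite_mul, zero_mul]
  rw [add_comm]
  simp only [wrd, opX, LinearMap.coe_mk, AddHom.coe_mk]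
  congr 1
  · rw [← Finset.sum_filter]
    apply Finset.sum_congr _ (fun _ _ => rfl)
    ext m
    simp only [Finset.mem_filter, Finset.mem_range, Finset.mem_Ico]
    omega
  · split_ifs with hk
    · subst hk
      simp only [true_and]
      rw [← Finset.sum_filter]
      apply Finset.sum_subset
      · intro m
        simp only [Finset.mem_filter, Finset.mem_range, Finset.mem_Ico]
        omega
      · intro m h1 h2
        simp only [Finset.mem_filter, Finset.mem_range, Finset.mem_Ico] at h1 h2
        have : m = N := by omega
        simp [this]
    · simp [hk]

lemma TT_wrd (N : ℕ) (l h : List ℕ) : TT N l (wrd h N) = wrd (l.reverse ++ h) N N := by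
  induction l generalizing h with
  | nil => simp [TT, zfst]
  | cons k l ih =>
    rw [TT_cons]
    have : TT N l (fun x => ∑ m : Fin N, zker N k m x * wrd h N m) = TT N l (wrd (k :: h) N) := by
      unfold TT
      apply Finset.sum_congr rfl
      intro n _
      congr 1
      apply ker_wrd
      unfold zfst
      split_ifs
      · exact (n _).2.le
      · exact le_rfl
    rw [this, ih]
    simp

lemma zdiaL_wrd (N : ℕ) (l : List ℕ) : zdiaL N l = wrd l.reverse N N := by
  rw [zdiaL_eq]
  have := TT_wrd N l []
  simpa [TT, wrd] using this

section

open Polynomial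

lemma poly_zero_of_eval {p : ℚ[X]} (h : ∀ N : ℕ, 1 ≤ N → p.eval (N : ℚ) = 0) : p = 0 := by
  apply Polynomial.eq_zero_of_infinite_isRoot
  apply Set.Infinite.mono (s := (fun n : ℕ => ((n + 1 : ℕ) : ℚ)) '' Set.univ)
  · rintro _ ⟨n, -, rfl⟩
    exact h (n + 1) (by omega)
  · apply Set.Infinite.image _ Set.infinite_univ
    intro a _ b _ hab
    simpa using hab

lemma ratio_const {a p : ℚ[X]} (ha : a ≠ 0)
    (h : a * p.comp (X + 1) - a.comp (X + 1) * p = 0) : ∃ c : ℚ, p = C c * a := by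
  have hev : ∀ x : ℚ, a.eval x * p.eval (x + 1) = a.eval (x + 1) * p.eval x := by
    intro x
    have := congrArg (Polynomial.eval x) h
    simp at this
    linarith
  obtain ⟨N0, hN0⟩ : ∃ N0 : ℕ, ∀ n : ℕ, N0 ≤ n → a.eval (n : ℚ) ≠ 0 := by
    have hfin : {n : ℕ | a.eval (n : ℚ) = 0}.Finite := by
      have := Polynomial.finite_setOfPred_isRoot ha
      exact Set.Finite.preimage (f := fun n : ℕ => (n : ℚ))
        (fun x _ y _ h => by simpa using h) this
    obtain ⟨B, hB⟩ := hfin.bddAbove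
    refine ⟨B + 1, fun n hn h => ?_⟩
    have := hB h
    omega
  refine ⟨p.eval (N0 : ℚ) / a.eval (N0 : ℚ), ?_⟩
  have key : ∀ n : ℕ, N0 ≤ n → p.eval (n : ℚ) = p.eval (N0 : ℚ) / a.eval (N0 : ℚ) * a.eval (n : ℚ) := by
    intro n hn
    induction n, hn using Nat.le_induction with
    | base => field_simp [hN0 N0 le_rfl]
    | succ n hn ih =>
      have := hev n
      rw [ih] at this
      have h0 := hN0 n hn
      push_cast
      apply mul_left_cancel₀ h0
      rw [this]
      ring
  rw [← sub_eq_zero]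
  apply Polynomial.eq_zero_of_infinite_isRoot
  apply Set.Infinite.mono (s := (fun n : ℕ => ((n : ℕ) : ℚ)) '' Set.Ici N0)
  · rintro _ ⟨n, hn, rfl⟩
    simp [Polynomial.IsRoot, key n hn]
  · apply Set.Infinite.image _ (Set.Ici_infinite N0)
    intro a _ b _ hab
    simpa using hab

/-- no rational function has difference a nonzero polynomial in `1/X` without constant term. -/
lemma no_pole (a b s : ℚ[X]) (J : ℕ) (hJ : 1 ≤ J) (ha : a ≠ 0) (hs : s.eval 0 ≠ 0)
    (h : X ^ J * (a * b.comp (X + 1) - a.comp (X + 1) * b) + a * a.comp (X + 1) * s = 0) :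
    False := by
  -- reduce to the coprime case
  obtain ⟨g, a', b', hg, hu, ha', hb'⟩ : ∃ g a' b' : ℚ[X], g ≠ 0 ∧ IsCoprime a' b' ∧
      a = g * a' ∧ b = g * b' := by
    have hg : EuclideanDomain.gcd a b ≠ 0 := by
      intro h0
      exact ha (EuclideanDomain.gcd_eq_zero_iff.1 h0).1
    obtain ⟨a', ha'⟩ := EuclideanDomain.gcd_dvd_left a b
    obtain ⟨b', hb'⟩ := EuclideanDomain.gcd_dvd_right a b
    refine ⟨_, a', b', hg, ?_, ha', hb'⟩
    refine ⟨EuclideanDomain.gcdA a b, EuclideanDomain.gcdB a b, ?_⟩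
    have := EuclideanDomain.gcd_eq_gcd_ab a b
    apply mul_left_cancel₀ hg
    calc _ = (EuclideanDomain.gcd a b * a') * EuclideanDomain.gcdA a b +
        (EuclideanDomain.gcd a b * b') * EuclideanDomain.gcdB a b := by ring
      _ = _ := by rw [← ha', ← hb', ← this, mul_one]
  subst ha' hb'
  have ha0 : a' ≠ 0 := right_ne_zero_of_mul ha
  have hgc : g.comp (X + 1) ≠ 0 := by
    intro h0
    apply hg
    have := congrArg (fun q => q.comp (X - 1)) h0
    simpa [Polynomial.comp_assoc] using this
  have h' : X ^ J * (a' * b'.comp (X + 1) - a'.comp (X + 1) * b') + a' * a'.comp (X + 1) * s = 0 := by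
    have : (g * g.comp (X + 1)) * (X ^ J * (a' * b'.comp (X + 1) - a'.comp (X + 1) * b') +
        a' * a'.comp (X + 1) * s) = 0 := by
      rw [← h]
      simp only [Polynomial.mul_comp]
      ring
    rcases mul_eq_zero.1 this with h1 | h1
    · exact absurd h1 (mul_ne_zero hg hgc)
    · exact h1
  have ev : ∀ x : ℚ, x ^ J * (a'.eval x * b'.eval (x + 1) - a'.eval (x + 1) * b'.eval x) +
      a'.eval x * a'.eval (x + 1) * s.eval x = 0 := by
    intro x
    have := congrArg (Polynomial.eval x) h'
    simpa using this
  have cop : ∀ x : ℚ, a'.eval x = 0 → b'.eval x ≠ 0 := by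
    intro x h1 h2
    obtain ⟨u, v, huv⟩ := hu
    have := congrArg (Polynomial.eval x) huv
    simp [h1, h2] at this
  have hfin : {n : ℤ | a'.eval (n : ℚ) = 0}.Finite := by
    have := Polynomial.finite_setOfPred_isRoot ha0
    exact Set.Finite.preimage (f := fun n : ℤ => (n : ℚ))
      (fun x _ y _ h => by simpa using h) this
  have hne : {n : ℤ | a'.eval (n : ℚ) = 0}.Nonempty := by
    have := ev 0
    rw [zero_pow (by omega)] at this
    simp only [zero_mul, zero_add, mul_eq_zero] at this
    rcases this with (h1 | h1) | h1
    · exact ⟨0, by simpa using h1⟩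
    · exact ⟨1, by simpa using h1⟩
    · exact absurd h1 hs
  obtain ⟨M, hM, hM'⟩ := Set.exists_max_image _ id hfin hne
  obtain ⟨m, hm, hm'⟩ := Set.exists_min_image _ id hfin hne
  have M0 : M = 0 := by
    by_contra hM0
    have h1 : a'.eval (M : ℚ) = 0 := hM
    have h2 : a'.eval ((M : ℚ) + 1) ≠ 0 := by
      intro h2
      have := hM' (M + 1) (by simpa using h2)
      simp at this
    have := ev M
    rw [h1] at this
    have h3 : (M : ℚ) ^ J ≠ 0 := pow_ne_zero _ (by exact_mod_cast hM0)
    have h4 := cop _ h1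
    simp only [zero_mul, zero_sub, add_zero, mul_eq_zero, neg_eq_zero] at this
    tauto
  have m1 : m = 1 := by
    by_contra hm0
    have h1 : a'.eval (m : ℚ) = 0 := hm
    have h2 : a'.eval ((m : ℚ) - 1) ≠ 0 := by
      intro h2
      have := hm' (m - 1) (by simpa using h2)
      simp at this
    have := ev (m - 1)
    rw [sub_add_cancel, h1] at this
    have h3 : ((m : ℚ) - 1) ^ J ≠ 0 := pow_ne_zero _ (by
      rw [sub_ne_zero]; exact_mod_cast hm0)
    have h4 := cop _ h1
    simp only [zero_mul, mul_zero, sub_zero, add_zero, mul_eq_zero] at this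
    tauto
  have := hm' M hM
  simp at this
  omega

/-- the version needed: `s` has degree `< K`. -/
lemma no_pole' (a b : ℚ[X]) (K : ℕ) (c : ℕ → ℚ) (ha : a ≠ 0)
    (hc : ∃ j ∈ Finset.Icc 1 K, c j ≠ 0)
    (h : X ^ K * (a * b.comp (X + 1) - a.comp (X + 1) * b) +
      a * a.comp (X + 1) * ∑ j ∈ Finset.Icc 1 K, C (c j) * X ^ (K - j) = 0) : False := by
  -- the largest such j
  obtain ⟨J, hJ, hJ'⟩ := Finset.exists_max_image
    ((Finset.Icc 1 K).filter (fun j => c j ≠ 0)) id (by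
      obtain ⟨j, h1, h2⟩ := hc
      exact ⟨j, by simp only [Finset.mem_filter]; exact ⟨h1, h2⟩⟩)
  simp only [Finset.mem_filter, Finset.mem_Icc] at hJ hJ'
  have hs : ∑ j ∈ Finset.Icc 1 K, C (c j) * X ^ (K - j) =
      X ^ (K - J) * ∑ j ∈ Finset.Icc 1 J, C (c j) * X ^ (J - j) := by
    rw [Finset.mul_sum]
    symm
    apply Finset.sum_subset_zero_on_sdiff (Finset.Icc_subset_Icc le_rfl hJ.1.2)
    · intro j hj
      simp only [Finset.mem_sdiff, Finset.mem_Icc] at hj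
      have : c j = 0 := by
        by_contra h0
        have := hJ' j ⟨hj.1, h0⟩
        simp at this
        omega
      simp [this]
    · intro j hj
      have hj := Finset.mem_Icc.1 hj
      rw [show K - j = (K - J) + (J - j) by omega, pow_add]
      ring
  refine no_pole a b (∑ j ∈ Finset.Icc 1 J, C (c j) * X ^ (J - j)) J hJ.1.1 ha ?_ ?_
  · rw [Polynomial.eval_finsetSum, Finset.sum_eq_single J]
    · simpa using hJ.2
    · intro j hj hne
      have hj := Finset.mem_Icc.1 hj
      have : J - j ≠ 0 := by omega
      simp [this]
    · intro h0
      exact absurd (Finset.mem_Icc.2 ⟨hJ.1.1, le_rfl⟩) h0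
  · rw [hs] at h
    have hx : (X : ℚ[X]) ^ (K - J) ≠ 0 := pow_ne_zero _ Polynomial.X_ne_zero
    apply mul_left_cancel₀ hx
    rw [mul_zero, ← h]
    have : (X : ℚ[X]) ^ K = X ^ (K - J) * X ^ J := by
      rw [← pow_add]; congr 1; omega
    rw [this]
    ring

/-- all lists of length at most `d` with entries in `[1,K]`. -/
def LL (K : ℕ) : ℕ → Finset (List ℕ)
  | 0 => {[]}
  | d + 1 => insert [] ((Finset.Icc 1 K ×ˢ LL K d).image (fun p => p.1 :: p.2))

lemma mem_LL (K d : ℕ) (l : List ℕ) :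
    l ∈ LL K d ↔ l.length ≤ d ∧ ∀ x ∈ l, 1 ≤ x ∧ x ≤ K := by
  induction d generalizing l with
  | zero =>
    simp only [LL, Finset.mem_singleton]
    constructor
    · rintro rfl; simp
    · rintro ⟨h, -⟩
      exact List.length_eq_zero_iff.1 (by omega)
  | succ d ih =>
    cases l with
    | nil => simp [LL]
    | cons k l =>
      simp only [LL, Finset.mem_insert, Finset.mem_image, Finset.mem_product, Prod.exists,
        Finset.mem_Icc, ih]
      simp
      tauto

lemma sum_LL (K d : ℕ) (f : List ℕ → ℚ) :
    ∑ l ∈ LL K (d + 1), f l = f [] + ∑ l ∈ LL K d, ∑ j ∈ Finset.Icc 1 K, f (j :: l) := by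
  rw [LL, Finset.sum_insert (by simp), Finset.sum_image (by rintro ⟨a, b⟩ _ ⟨c, d⟩ _ h; simpa using h),
    Finset.sum_product, Finset.sum_comm]

lemma zz_indep (K d : ℕ) : ∀ p : List ℕ → ℚ[X], (∀ l, l ∉ LL K d → p l = 0) →
    (∀ N : ℕ, 1 ≤ N → ∑ l ∈ LL K d, (p l).eval (N : ℚ) * zz l N = 0) → ∀ l, p l = 0 := by
  induction d with
  | zero =>
    intro p hp h l
    by_cases hl : l ∈ LL K 0
    · have : l = [] := by simpa [LL] using hl
      subst this
      apply poly_zero_of_eval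
      intro N hN
      simpa [LL, zz] using h N hN
    · exact hp l hl
  | succ d ih =>
    -- inner induction on the number of top terms
    have inner : ∀ c : ℕ, ∀ p : List ℕ → ℚ[X], (∀ l, l ∉ LL K (d + 1) → p l = 0) →
        (∀ N : ℕ, 1 ≤ N → ∑ l ∈ LL K (d + 1), (p l).eval (N : ℚ) * zz l N = 0) →
        ((LL K (d + 1)).filter (fun l => l.length = d + 1 ∧ p l ≠ 0)).card = c →
        ∀ l, p l = 0 := by
      intro c
      induction c using Nat.strong_induction_on with
      | _ c ihc =>
      intro p hp h hc
      by_cases hex : ∃ l0, l0.length = d + 1 ∧ p l0 ≠ 0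
      swap
      · push Not at hex
        have sub : LL K d ⊆ LL K (d + 1) := by
          intro l hl
          rw [mem_LL] at hl ⊢
          exact ⟨by omega, hl.2⟩
        have hz : ∀ l, l ∉ LL K d → p l = 0 := by
          intro l hl
          by_cases hl' : l ∈ LL K (d + 1)
          · apply hex
            rw [mem_LL] at hl hl'
            have : ¬ l.length ≤ d := fun h => hl ⟨h, hl'.2⟩
            omega
          · exact hp l hl'
        apply ih p hz
        intro N hN
        rw [← h N hN]
        apply Finset.sum_subset sub
        intro l _ hl
        rw [hz l hl]; simp
      · exfalso
        obtain ⟨l0, hl0, ha⟩ := hex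
        have hl0mem : l0 ∈ LL K (d + 1) := by
          by_contra h0
          exact ha (hp l0 h0)
        set a := p l0 with ha_def
        set p' : List ℕ → ℚ[X] := fun l =>
          X ^ K * (a * (p l).comp (X + 1) - a.comp (X + 1) * p l) +
            a * ∑ j ∈ Finset.Icc 1 K, X ^ (K - j) * (p (j :: l)).comp (X + 1) with hp'
        have top : ∀ l : List ℕ, d + 1 ≤ l.length → p' l =
            X ^ K * (a * (p l).comp (X + 1) - a.comp (X + 1) * p l) := by
          intro l hl
          have : ∀ j, p (j :: l) = 0 := by
            intro j
            apply hp
            rw [mem_LL]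
            simp
            omega
          simp [hp', this]
        have p'0 : ∀ l, p' l = 0 := by
          refine ihc _ ?_ p' ?_ ?_ rfl
          · rw [← hc]
            apply Finset.card_lt_card
            rw [Finset.ssubset_iff_of_subset]
            · refine ⟨l0, ?_, ?_⟩
              · simp only [Finset.mem_filter]
                exact ⟨hl0mem, hl0, ha⟩
              · simp only [Finset.mem_filter, not_and, not_not]
                intro _ _
                rw [top l0 hl0.ge, ← ha_def]
                ring
            · intro l hl
              simp only [Finset.mem_filter] at hl ⊢
              refine ⟨hl.1, hl.2.1, ?_⟩
              intro h0
              apply hl.2.2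
              rw [top l hl.2.1.ge, h0]
              simp
          · intro l hl
            have e1 : p l = 0 := hp l hl
            have e2 : ∀ j ∈ Finset.Icc 1 K, p (j :: l) = 0 := by
              intro j hj
              apply hp
              rw [mem_LL] at hl ⊢
              intro h0
              apply hl
              refine ⟨?_, fun x hx => h0.2 x (by simp [hx])⟩
              have := h0.1
              simp at this
              omega
            simp only [hp', e1]
            rw [Finset.sum_eq_zero (by intro j hj; rw [e2 j hj]; simp)]
            simp
          · intro N hN
            have hN0 : (N : ℚ) ≠ 0 := by positivity
            have r1 := h N hN
            have r2 := h (N + 1) (by omega)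
            -- expand r2
            have r3 : ∑ l ∈ LL K (d + 1), (p l).eval ((N : ℚ) + 1) * zz l (N + 1) =
                ∑ l ∈ LL K (d + 1), (p l).eval ((N : ℚ) + 1) * zz l N +
                ∑ l ∈ LL K (d + 1), ∑ j ∈ Finset.Icc 1 K,
                  (p (j :: l)).eval ((N : ℚ) + 1) * (1 / (N : ℚ) ^ j) * zz l N := by
              rw [sum_LL, sum_LL K d (fun l => (p l).eval ((N : ℚ) + 1) * zz l N)]
              have sub : LL K d ⊆ LL K (d + 1) := by
                intro l hl
                rw [mem_LL] at hl ⊢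
                exact ⟨by omega, hl.2⟩
              rw [← Finset.sum_subset sub (f := fun l => ∑ j ∈ Finset.Icc 1 K,
                  (p (j :: l)).eval ((N : ℚ) + 1) * (1 / (N : ℚ) ^ j) * zz l N)]
              · rw [add_assoc, ← Finset.sum_add_distrib]
                congr 1
                apply Finset.sum_congr rfl
                intro l _
                rw [← Finset.sum_add_distrib]
                apply Finset.sum_congr rfl
                intro j _
                rw [zz_succ j l N hN]
                ring
              · intro l h1 h2
                apply Finset.sum_eq_zero
                intro j hj
                have : p (j :: l) = 0 := by
                  apply hp
                  rw [mem_LL] at h1 h2 ⊢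
                  intro h0
                  apply h2
                  have := h0.1
                  simp at this
                  exact ⟨by omega, h1.2⟩
                simp [this]
            push_cast at r2
            rw [r3] at r2
            have : ∑ l ∈ LL K (d + 1), (p' l).eval (N : ℚ) * zz l N =
                (N : ℚ) ^ K * a.eval (N : ℚ) *
                  (∑ l ∈ LL K (d + 1), (p l).eval ((N : ℚ) + 1) * zz l N +
                ∑ l ∈ LL K (d + 1), ∑ j ∈ Finset.Icc 1 K,
                  (p (j :: l)).eval ((N : ℚ) + 1) * (1 / (N : ℚ) ^ j) * zz l N) -
                (N : ℚ) ^ K * a.eval ((N : ℚ) + 1) *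
                  ∑ l ∈ LL K (d + 1), (p l).eval (N : ℚ) * zz l N := by
              rw [← Finset.sum_add_distrib, Finset.mul_sum, Finset.mul_sum,
                ← Finset.sum_sub_distrib]
              apply Finset.sum_congr rfl
              intro l _
              have e : ∑ j ∈ Finset.Icc 1 K, (N : ℚ) ^ (K - j) * (p (j :: l)).eval ((N : ℚ) + 1) * zz l N =
                  (N : ℚ) ^ K * ∑ j ∈ Finset.Icc 1 K,
                  (p (j :: l)).eval ((N : ℚ) + 1) * (1 / (N : ℚ) ^ j) * zz l N := by
                rw [Finset.mul_sum]
                apply Finset.sum_congr rfl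
                intro j hj
                have hj := Finset.mem_Icc.1 hj
                have : (N : ℚ) ^ K = (N : ℚ) ^ (K - j) * (N : ℚ) ^ j := by
                  rw [← pow_add]; congr 1; omega
                rw [this]
                field_simp
              rw [← Finset.sum_mul] at e
              simp only [hp', eval_add, eval_sub, eval_mul, eval_pow, eval_X, eval_comp, eval_one,
                eval_finsetSum]
              linear_combination (a.eval (N : ℚ)) * e
            rw [this, r1, r2]
            ring
        -- analyze
        have cst : ∀ l : List ℕ, d + 1 ≤ l.length → ∃ c : ℚ, p l = C c * a := by
          intro l hl
          apply ratio_const ha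
          have := p'0 l
          rw [top l hl] at this
          exact (mul_eq_zero.1 this).resolve_left (pow_ne_zero _ X_ne_zero)
        cases l0 with
        | nil => simp at hl0
        | cons j0 l1 =>
          have hl1 : l1.length = d := by simpa using hl0
          have : ∀ j : ℕ, ∃ c : ℚ, p (j :: l1) = C c * a := fun j => cst _ (by simp [hl1])
          choose cc hcc using this
          have hj0 : j0 ∈ Finset.Icc 1 K := by
            rw [mem_LL] at hl0mem
            exact Finset.mem_Icc.2 (hl0mem.2 j0 (by simp))
          refine no_pole' a (p l1) K cc ha ⟨j0, hj0, ?_⟩ ?_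
          · intro h0
            apply ha
            rw [ha_def, hcc, h0]
            simp
          · rw [← p'0 l1]
            simp only [hp']
            rw [mul_assoc, Finset.mul_sum _ _ (a.comp (X + 1))]
            congr 2
            apply Finset.sum_congr rfl
            intro j _
            rw [hcc j]
            simp
            ring
    intro p hp h
    exact inner _ p hp h rfl

end

/-- increase the first entry of a list by one. -/
def incHead : List ℕ → List ℕ
  | [] => []
  | a :: t => (a + 1) :: t

/-- lists of weight `n` with all entries at least two. -/
def FF : ℕ → Finset (List ℕ)
  | 0 => {[]}
  | 1 => ∅
  | n + 2 => (FF n).image (fun l => 2 :: l) ∪ (FF (n + 1)).image incHead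

lemma mem_FF (n : ℕ) : ∀ l : List ℕ, l ∈ FF n ↔ l.sum = n ∧ ∀ x ∈ l, 2 ≤ x := by
  induction n using Nat.strong_induction_on with
  | _ n ih =>
  intro l
  match n, ih with
  | 0, _ =>
    simp only [FF, Finset.mem_singleton]
    constructor
    · rintro rfl; simp
    · rintro ⟨h1, h2⟩
      cases l with
      | nil => rfl
      | cons a t =>
        have := h2 a (by simp)
        simp at h1
        omega
  | 1, _ =>
    simp only [FF, Finset.notMem_empty, false_iff]
    rintro ⟨h1, h2⟩
    cases l with
    | nil => simp at h1
    | cons a t =>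
      have := h2 a (by simp)
      simp at h1
      omega
  | n + 2, ih =>
    simp only [FF, Finset.mem_union, Finset.mem_image]
    constructor
    · rintro (⟨m, hm, rfl⟩ | ⟨m, hm, rfl⟩)
      · rw [ih n (by omega)] at hm
        refine ⟨by simp [hm.1]; omega, ?_⟩
        intro x hx
        rcases List.mem_cons.1 hx with rfl | hx
        · exact le_rfl
        · exact hm.2 x hx
      · rw [ih (n + 1) (by omega)] at hm
        cases m with
        | nil => simp at hm
        | cons a t =>
          have h1 := hm.1
          simp only [List.sum_cons] at h1
          refine ⟨by simp [incHead]; omega, ?_⟩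
          intro x hx
          rcases List.mem_cons.1 hx with rfl | hx
          · have := hm.2 a (by simp)
            omega
          · exact hm.2 x (by simp [hx])
    · rintro ⟨h1, h2⟩
      cases l with
      | nil => simp at h1
      | cons a t =>
        have ha := h2 a (by simp)
        simp only [List.sum_cons] at h1
        by_cases h : a = 2
        · left
          refine ⟨t, (ih n (by omega) t).2 ⟨by omega, fun x hx => h2 x (by simp [hx])⟩, by rw [h]⟩
        · right
          refine ⟨(a - 1) :: t, (ih (n + 1) (by omega) _).2 ⟨?_, ?_⟩, ?_⟩
          · simp only [List.sum_cons]; omega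
          · intro x hx
            rcases List.mem_cons.1 hx with rfl | hx
            · omega
            · exact h2 x (by simp [hx])
          · simp only [incHead]
            congr 1
            omega

lemma incHead_inj : Function.Injective incHead := by
  intro a b h
  cases a <;> cases b <;> simp_all [incHead]

lemma card_FF_succ (n : ℕ) : (FF (n + 1)).card = Nat.fib n ∧ (FF (n + 2)).card = Nat.fib (n + 1) := by
  have key : ∀ n, (FF (n + 2)).card = (FF n).card + (FF (n + 1)).card := by
    intro n
    rw [FF, Finset.card_union_of_disjoint, Finset.card_image_of_injective,
      Finset.card_image_of_injective _ incHead_inj]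
    · intro a b h
      simpa using h
    · rw [Finset.disjoint_left]
      rintro l hl hl'
      rw [Finset.mem_image] at hl hl'
      obtain ⟨a, ha, rfl⟩ := hl
      obtain ⟨b, hb, h⟩ := hl'
      rw [mem_FF] at hb
      cases b with
      | nil => simp [incHead] at h
      | cons x t =>
        have := hb.2 x (by simp)
        simp only [incHead, List.cons.injEq] at h
        omega
  induction n with
  | zero =>
    refine ⟨by simp [FF], ?_⟩
    rw [key]
    simp [FF]
  | succ n ih =>
    refine ⟨ih.2, ?_⟩
    rw [show n + 1 + 2 = (n + 1) + 2 from rfl, key, ih.1, show n + 1 + 1 = n + 2 from rfl, ih.2,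
      Nat.fib_add_two]

lemma card_comp (k : ℕ) (hk : 2 ≤ k) :
    Fintype.card {l : Composition k // ∀ x ∈ l.blocks, 2 ≤ x} = Nat.fib (k - 1) := by
  obtain ⟨n, rfl⟩ : ∃ n, k = n + 1 := ⟨k - 1, by omega⟩
  rw [Nat.add_sub_cancel, ← (card_FF_succ n).1, ← Fintype.card_coe]
  refine Fintype.card_congr
    { toFun := fun l => ⟨l.1.blocks, (mem_FF _ _).2 ⟨l.1.blocks_sum, l.2⟩⟩
      invFun := fun l => ⟨⟨l.1, fun {i} hi => by
        have := ((mem_FF _ _).1 l.2).2 i hi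
        omega, ((mem_FF _ _).1 l.2).1⟩, ((mem_FF _ _).1 l.2).2⟩
      left_inv := fun l => by simp
      right_inv := fun l => by simp }

lemma zdiaSeq_zz (l : List ℕ) (hl : ∀ x ∈ l, 2 ≤ x) (N : ℕ+) :
    zdiaSeq l N = zz l.reverse N := by
  simp only [zdiaSeq]
  rw [zdiaL_wrd, wrd_eq_zz]
  intro x hx
  exact hl x (by simpa using hx)

lemma zdia_linInd (k : ℕ) : LinearIndependent ℚ
    (fun l : {l : Composition k // ∀ x ∈ l.blocks, 2 ≤ x} => zdiaSeq l.1.blocks) := by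
  rw [Fintype.linearIndependent_iff]
  intro c hc
  have hmem : ∀ l : {l : Composition k // ∀ x ∈ l.blocks, 2 ≤ x},
      l.1.blocks.reverse ∈ LL k k := by
    intro l
    rw [mem_LL]
    refine ⟨?_, ?_⟩
    · rw [List.length_reverse]
      exact l.1.length_le
    · intro x hx
      have hx : x ∈ l.1.blocks := by simpa using hx
      refine ⟨l.1.blocks_pos hx, ?_⟩
      have := List.le_sum_of_mem hx
      rwa [l.1.blocks_sum] at this
  have := zz_indep k k (fun w => ∑ l : {l : Composition k // ∀ x ∈ l.blocks, 2 ≤ x},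
    if l.1.blocks.reverse = w then Polynomial.C (c l) else 0) ?_ ?_
  · intro l
    have h := this l.1.blocks.reverse
    rw [Finset.sum_eq_single l] at h
    · simpa using h
    · intro l' _ hne
      rw [if_neg]
      intro h'
      apply hne
      apply Subtype.ext
      apply Composition.ext
      exact List.reverse_injective h'
    · simp
  · intro w hw
    apply Finset.sum_eq_zero
    intro l _
    rw [if_neg]
    rintro rfl
    exact hw (hmem l)
  · intro N hN
    have h' : ∀ M : ℕ+, ∑ l : {l : Composition k // ∀ x ∈ l.blocks, 2 ≤ x},
        c l * zdiaSeq l.1.blocks M = 0 := by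
      intro M
      have := congrFun hc M
      rw [Finset.sum_apply] at this
      exact this
    obtain ⟨M, rfl⟩ : ∃ M : ℕ+, (M : ℕ) = N := ⟨⟨N, hN⟩, rfl⟩
    have h := h' M
    rw [← h]
    simp only [Polynomial.eval_finsetSum, Finset.sum_mul]
    rw [Finset.sum_comm]
    apply Finset.sum_congr rfl
    intro l _
    rw [Finset.sum_eq_single l.1.blocks.reverse]
    · rw [zdiaSeq_zz _ l.2]
      simp
    · intro b _ hb
      rw [if_neg (Ne.symm hb)]
      simp
    · intro h0
      exact absurd (hmem l) h0

lemma zdia_span (k : ℕ) (hk : 2 ≤ k) : Submodule.span ℚ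
        (Set.range (fun l : {l : Composition k // ∀ x ∈ l.blocks, 2 ≤ x} =>
          zdiaSeq l.1.blocks)) =
      Submodule.span ℚ {x : ℕ+ → ℚ | ∃ κ : Composition k,
        (∃ m, κ.blocks.getLast? = some m ∧ 2 ≤ m) ∧ x = zdiaSeq κ.blocks} := by
  apply le_antisymm
  · apply Submodule.span_mono
    rintro _ ⟨l, rfl⟩
    refine ⟨l.1, ?_, rfl⟩
    have hne : l.1.blocks ≠ [] := by
      intro h
      have := l.1.blocks_sum
      rw [h] at this
      simp at this
      omega
    exact ⟨_, List.getLast?_eq_some_getLast hne, l.2 _ (List.getLast_mem hne)⟩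
  · have hB : BB k ≤ Submodule.span ℚ
        (Set.range (fun l : {l : Composition k // ∀ x ∈ l.blocks, 2 ≤ x} =>
          zdiaSeq l.1.blocks)) := by
      rw [BB, Submodule.span_le]
      rintro _ ⟨l, hs, h2, rfl⟩
      apply Submodule.subset_span
      refine ⟨⟨⟨l.reverse, fun {i} hi => ?_, ?_⟩, ?_⟩, ?_⟩
      · have := h2 i (by simpa using hi)
        omega
      · rw [List.sum_reverse, hs]
      · intro x hx
        exact h2 x (by simpa using hx)
      · funext N
        simp only
        rw [zdiaSeq_zz, List.reverse_reverse]
        intro x hx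
        exact h2 x (by simpa using hx)
    rw [Submodule.span_le]
    rintro _ ⟨κ, ⟨m, hm, h2⟩, rfl⟩
    apply hB
    have := wrd_mem_BB k κ.blocks.reverse (by rw [List.sum_reverse, κ.blocks_sum])
      (fun x hx => κ.blocks_pos (by simpa using hx)) (by
        intro x hx
        rw [List.head?_reverse, hm] at hx
        simp at hx
        omega)
    convert this using 1
    funext N
    simp only [zdiaSeq]
    rw [zdiaL_wrd]

/-- **Theorem.**  Let `k ≥ 2`.  The family `{ζ◇(l) : l ∈ I^{≥2}_k}` is a basis of the
`ℚ`-subspace `Z◇_k` of `ℚ^ℕ` spanned by `{ζ◇(κ) : κ ∈ I^adm_k}`:  it is linearly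
independent and spans `Z◇_k`; in particular `dim_ℚ Z◇_k = F_{k-1}`.
Indices of weight `k` are encoded as `Composition k`. -/
theorem zdiaSeq_basis (k : ℕ) (hk : 2 ≤ k) :
    LinearIndependent ℚ
      (fun l : {l : Composition k // ∀ x ∈ l.blocks, 2 ≤ x} => zdiaSeq l.1.blocks) ∧
    Submodule.span ℚ
        (Set.range (fun l : {l : Composition k // ∀ x ∈ l.blocks, 2 ≤ x} =>
          zdiaSeq l.1.blocks)) =
      Submodule.span ℚ {x : ℕ+ → ℚ | ∃ κ : Composition k,
        (∃ m, κ.blocks.getLast? = some m ∧ 2 ≤ m) ∧ x = zdiaSeq κ.blocks} ∧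
    Module.rank ℚ ↥(Submodule.span ℚ {x : ℕ+ → ℚ | ∃ κ : Composition k,
        (∃ m, κ.blocks.getLast? = some m ∧ 2 ≤ m) ∧ x = zdiaSeq κ.blocks}) =
      (Nat.fib (k - 1) : Cardinal) := by
  refine ⟨zdia_linInd k, zdia_span k hk, ?_⟩
  rw [← zdia_span k hk, rank_span (zdia_linInd k), Cardinal.mk_range_eq _ (zdia_linInd k).injective,
    Cardinal.mk_fintype, card_comp k hk]
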